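/- Let p be a prime and let G be a non-abelian group of order p^n whose Chermak-Delgado measure takes exactly two distinct values on its subgroups. Then the set of values of m_G is exactly {p^n, p^{n+1}}; in particular the maximal Chermak-Delgado measure m*(G) equals p^{n+1}. -/

import Mathlib

/-- The Chermak–Delgado measure of a subgroup `H` of `G`: `|H| * |C_G(H)|`. -/
noncomputable def cdMeasure {G : Type*} [Group G] (H : Subgroup G) : ℕ :=
  Nat.card H * Nat.card (Subgroup.centralizer (H : Set G))

/-- `G` belongs to the class `C`: its Chermak–Delgado measure takes exactly two
distinct values on the subgroups of `G`. -/
def hasTwoCDValues (G : Type*) [Group G] : Prop :=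
  (Set.range fun H : Subgroup G => cdMeasure H).ncard = 2

/-- The measure of a central subgroup is its order times the order of the group. -/
theorem cdMeasure_of_le_center {G : Type*} [Group G] {H : Subgroup G}
    (h : H ≤ Subgroup.center G) : cdMeasure H = Nat.card H * Nat.card G := by
  rw [cdMeasure, Subgroup.centralizer_eq_top_iff_subset.mpr h, Subgroup.card_top]

/-- The center of a nontrivial finite `p`-group contains a subgroup of order `p`. -/
theorem IsPGroup.exists_le_center_card_eq {G : Type*} [Group G] [Finite G] [Nontrivial G]
    {p : ℕ} [Fact p.Prime] (hG : IsPGroup p G) :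
    ∃ H : Subgroup G, H ≤ Subgroup.center G ∧ Nat.card H = p := by
  have := hG.center_nontrivial
  obtain ⟨k, hk, hcard⟩ := (hG.to_subgroup (Subgroup.center G)).nontrivial_iff_card.mp this
  obtain ⟨z, hz⟩ := exists_prime_orderOf_dvd_card' (G := Subgroup.center G) p
    (hcard ▸ dvd_pow_self p hk.ne')
  refine ⟨Subgroup.zpowers (z : G), Subgroup.zpowers_le.mpr z.2, ?_⟩
  rw [Nat.card_zpowers, Subgroup.orderOf_coe, hz]

theorem cdMeasure_range_of_hasTwoCDValues (G : Type*) [Group G] [Finite G]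
    (p n : ℕ) (hp : p.Prime) (hcard : Nat.card G = p ^ n)
    (hnab : ¬ ∀ a b : G, a * b = b * a)
    (hG : hasTwoCDValues G) :
    (Set.range fun H : Subgroup G => cdMeasure H) = {p ^ n, p ^ (n + 1)} ∧
      sSup (Set.range fun H : Subgroup G => cdMeasure H) = p ^ (n + 1) := by
  have := Fact.mk hp
  have : Nontrivial G := by
    by_contra h
    rw [not_nontrivial_iff_subsingleton] at h
    exact hnab fun a b => Subsingleton.elim _ _
  obtain ⟨H, hHc, hHp⟩ := (IsPGroup.of_card hcard).exists_le_center_card_eq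
  have hlt : p ^ n < p ^ (n + 1) := Nat.pow_lt_pow_right hp.one_lt n.lt_succ_self
  have hsub : ({p ^ n, p ^ (n + 1)} : Set ℕ) ⊆ Set.range fun H : Subgroup G => cdMeasure H := by
    rintro x (rfl | rfl)
    · exact ⟨⊥, by simp [cdMeasure_of_le_center bot_le, hcard]⟩
    · exact ⟨H, by simp only [cdMeasure_of_le_center hHc, hHp, hcard, pow_succ']⟩
  have hrange : (Set.range fun H : Subgroup G => cdMeasure H) = {p ^ n, p ^ (n + 1)} := by
    refine (Set.eq_of_subset_of_ncard_le hsub ?_ (Set.finite_range _)).symm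
    rw [Set.ncard_pair hlt.ne]
    exact hG.le
  refine ⟨hrange, ?_⟩
  rw [hrange, csSup_pair]
  exact sup_eq_right.mpr hlt.le
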